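/- Under the abstract assumptions, for all initial data u⁰, v⁰ ∈ V such that there exists h⁰ ∈ H with (h⁰, w)_H = d(u⁰, w) + b(v⁰, w) for all w ∈ V, there exists a maximal existence time t* ∈ (0, ∞] such that for every T < t* the damped semilinear wave equation (u''(t), w)_H + d(u(t), w) + b(u'(t), w) = (G(u(t), u'(t)), w)_H + (f(t), w)_H for all w ∈ V on [0,T], with u(0) = u⁰ and u'(0) = v⁰, has a unique solution u which is continuously differentiable from [0,T] to V, whose derivative u' is Lipschitz continuous from [0,T] to H (so u ∈ W^{2,∞}([0,T]; H)), and for which there is a continuous map h : [0,T] → H with (h(t), w)_H = d(u(t), w) + b(u'(t), w) for all w ∈ V and all t ∈ [0,T]. -/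

import Mathlib

open Set
open scoped RealInnerProductSpace ENNReal

/-- The solution property for the damped semilinear wave equation on `[0,T]`:
`u : [0,T] → V` is continuously differentiable into `V` with derivative `u'`,
`u'` (viewed in `H` via the embedding `ι`) is Lipschitz continuous into `H`
(so `u ∈ W^{2,∞}([0,T];H)`) with (pointwise) second derivative `u'' : [0,T] → H`,
the weak equation
`(u''(t), w)_H + d(u(t), w) + b(u'(t), w) = (G(u(t),u'(t)), w)_H + (f(t), w)_H`
holds for all `w ∈ V` and `t ∈ [0,T]`, the initial conditions `u(0) = u⁰`,
`u'(0) = v⁰` hold, and there is a continuous map `hrep : [0,T] → H` with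
`(hrep(t), w)_H = d(u(t), w) + b(u'(t), w)` for all `w ∈ V`, `t ∈ [0,T]`. -/
def IsDampedWaveSolution
    {H V : Type*}
    [NormedAddCommGroup H] [InnerProductSpace ℝ H]
    [NormedAddCommGroup V] [InnerProductSpace ℝ V]
    (ι : V →ₗ[ℝ] H) (d b : V → V → ℝ) (G : V → H → H) (f : ℝ → H)
    (u0 v0 : V) (T : ℝ)
    (u u' : ℝ → V) (u'' hrep : ℝ → H) : Prop :=
  (∀ t ∈ Icc (0 : ℝ) T, HasDerivWithinAt u (u' t) (Icc (0 : ℝ) T) t) ∧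
  ContinuousOn u' (Icc (0 : ℝ) T) ∧
  (∃ K : NNReal, LipschitzOnWith K (fun t => ι (u' t)) (Icc (0 : ℝ) T)) ∧
  (∀ t ∈ Icc (0 : ℝ) T,
    HasDerivWithinAt (fun s => ι (u' s)) (u'' t) (Icc (0 : ℝ) T) t) ∧
  (∀ t ∈ Icc (0 : ℝ) T, ∀ w : V,
    ⟪u'' t, ι w⟫ + d (u t) w + b (u' t) w
      = ⟪G (u t) (ι (u' t)), ι w⟫ + ⟪f t, ι w⟫) ∧
  u 0 = u0 ∧ u' 0 = v0 ∧
  ContinuousOn hrep (Icc (0 : ℝ) T) ∧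
  (∀ t ∈ Icc (0 : ℝ) T, ∀ w : V, ⟪hrep t, ι w⟫ = d (u t) w + b (u' t) w)

open MeasureTheory Filter Topology in
theorem sq_norm_le_gronwallBound {X : Type*} [NormedAddCommGroup X] [InnerProductSpace ℝ X]
    {x x' : ℝ → X} {T K ε : ℝ}
    (hx : ∀ t ∈ Icc (0 : ℝ) T, HasDerivWithinAt x (x' t) (Icc 0 T) t)
    (hb : ∀ t ∈ Icc (0 : ℝ) T, 2 * ⟪x t, x' t⟫ ≤ K * ‖x t‖ ^ 2 + ε) :
    ∀ t ∈ Icc (0 : ℝ) T, ‖x t‖ ^ 2 ≤ gronwallBound (‖x 0‖ ^ 2) K ε t := by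
  have hd : ∀ t ∈ Icc (0 : ℝ) T,
      HasDerivWithinAt (fun t => ‖x t‖ ^ 2) (2 * ⟪x t, x' t⟫) (Icc 0 T) t :=
    fun t ht => (hx t ht).norm_sq
  intro t ht
  have key := le_gronwallBound_of_liminf_deriv_right_le (f := fun t => ‖x t‖ ^ 2)
    (f' := fun t => 2 * ⟪x t, x' t⟫) (δ := ‖x 0‖ ^ 2) (K := K) (ε := ε) (a := 0) (b := T)
    (fun t ht => (hd t ht).continuousWithinAt) ?_ le_rfl
    (fun t ht => hb t ⟨ht.1, ht.2.le⟩) t ht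
  · simpa using key
  · intro t ht r hr
    have h1 := (hd t ⟨ht.1, ht.2.le⟩).mono_of_mem_nhdsWithin (Icc_mem_nhdsGE_of_mem ht)
    simpa [slope_def_field, div_eq_inv_mul] using h1.liminf_right_slope_le hr

theorem gronwallBound_le_of_mul_le_one {a K ε t : ℝ} (ha : 0 ≤ a) (hK : 0 < K) (hε : 0 ≤ ε)
    (ht : 0 ≤ t) (hKt : K * t ≤ 1) : gronwallBound a K ε t ≤ 3 * a + 2 * ε * t := by
  rw [gronwallBound_of_K_ne_0 hK.ne']
  have h0 : 0 ≤ K * t := by positivity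
  have h1 := Real.abs_exp_sub_one_le (x := K * t) (by rwa [abs_of_nonneg h0])
  rw [abs_of_nonneg h0] at h1
  have h2 : Real.exp (K * t) - 1 ≤ 2 * (K * t) := (le_abs_self _).trans h1
  have h3 : ε / K * (Real.exp (K * t) - 1) ≤ ε / K * (2 * (K * t)) := by gcongr
  have h4 : ε / K * (2 * (K * t)) = 2 * ε * t := by field_simp
  have h5 : a * Real.exp (K * t) ≤ a * 3 := by gcongr; linarith
  simp only
  linarith

theorem sq_norm_le_of_dissipative {X : Type*} [NormedAddCommGroup X] [InnerProductSpace ℝ X]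
    {x x' : ℝ → X} {T K ε : ℝ} (hK : 0 < K) (hKT : K * T ≤ 1) (hε : 0 ≤ ε)
    (hx : ∀ t ∈ Icc (0 : ℝ) T, HasDerivWithinAt x (x' t) (Icc 0 T) t)
    (hb : ∀ t ∈ Icc (0 : ℝ) T, 2 * ⟪x t, x' t⟫ ≤ K * ‖x t‖ ^ 2 + ε) :
    ∀ t ∈ Icc (0 : ℝ) T, ‖x t‖ ^ 2 ≤ 3 * ‖x 0‖ ^ 2 + 2 * ε * t := fun t ht =>
  (sq_norm_le_gronwallBound hx hb t ht).trans
    (gronwallBound_le_of_mul_le_one (by positivity) hK hε ht.1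
      ((mul_le_mul_of_nonneg_left ht.2 hK.le).trans hKT))

open Filter Topology in
theorem exists_weak_limit_of_bounded {E : Type*} [NormedAddCommGroup E] [InnerProductSpace ℝ E]
    [CompleteSpace E] {s : ℕ → E} {M : ℝ} (hs : ∀ n, ‖s n‖ ≤ M) :
    ∃ z : E, ‖z‖ ≤ M ∧ ∀ (y : E) (l : ℝ),
      Tendsto (fun n => ⟪s n, y⟫) atTop (𝓝 l) → ⟪z, y⟫ = l := by
  let D := InnerProductSpace.toDual ℝ E
  have hc := WeakDual.isCompact_closedBall (𝕜 := ℝ) (E := E) 0 M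
  obtain ⟨φ, hφ, hcl⟩ := hc.exists_mapClusterPt (f := atTop)
    (u := fun n : ℕ => StrongDual.toWeakDual (D (s n))) (by
      refine le_principal_iff.2 (mem_map.2 (Eventually.of_forall fun n => ?_))
      simpa [D] using hs n)
  refine ⟨D.symm (WeakDual.toStrongDual φ), ?_, fun y l hl => ?_⟩
  · simpa using hφ
  · have h1 : MapClusterPt (φ y) atTop (fun n => ⟪s n, y⟫) :=
      hcl.continuousAt_comp (f := fun ψ : WeakDual ℝ E => ψ y)
        (WeakDual.eval_continuous y).continuousAt
    have h2 : φ y = l := eq_of_nhds_neBot (h1.clusterPt.mono hl)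
    simpa [D] using h2

open MeasureTheory Filter Topology in
/-- Lipschitz curves in a Hilbert space are primitives of integrable functions. -/
theorem LipschitzWith.exists_eq_integral {X : Type*} [NormedAddCommGroup X]
    [InnerProductSpace ℝ X] [CompleteSpace X] {k : ℝ → X} {C : NNReal} (hk : LipschitzWith C k)
    {T : ℝ} (hT : 0 ≤ T) :
    ∃ s : ℝ → X, IntegrableOn s (Ioc 0 T) ∧ (∀ t ∈ Icc 0 T, k t = k 0 + ∫ r in (0:ℝ)..t, s r) ∧
      ∫ r in Ioc 0 T, ‖s r‖ ≤ C * T := by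
  set μ : Measure ℝ := volume.restrict (Ioc 0 T) with hμ
  let q : ℕ → ℝ → X := fun n r => ((n:ℝ) + 1) • (k (r + ((n:ℝ)+1)⁻¹) - k r)
  have hqc : ∀ n, Continuous (q n) := fun n => by
    have := hk.continuous
    fun_prop
  have hqb : ∀ n r, ‖q n r‖ ≤ C := fun n r => by
    have hn : (0:ℝ) < n + 1 := by positivity
    have := hk.norm_sub_le (r + ((n:ℝ)+1)⁻¹) r
    rw [add_sub_cancel_left, Real.norm_of_nonneg (by positivity)] at this
    rw [norm_smul, Real.norm_of_nonneg hn.le]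
    calc _ ≤ ((n:ℝ)+1) * (C * ((n:ℝ)+1)⁻¹) := by gcongr
      _ = C := by field_simp
  have hqL : ∀ n, MemLp (q n) 2 μ := fun n =>
    MemLp.of_bound (hqc n).aestronglyMeasurable C (Eventually.of_forall (hqb n))
  obtain ⟨z, hz, hzl⟩ := exists_weak_limit_of_bounded (s := fun n => (hqL n).toLp (q n))
    (M := T ^ ((2:ℝ)⁻¹) * C) (fun n => by
      have := Lp.norm_le_of_ae_bound (f := (hqL n).toLp (q n)) (C := C) C.2
        ((hqL n).coeFn_toLp.mono fun r hr => by rw [hr]; exact hqb n r)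
      simpa [hμ, Measure.real, hT, measureUnivNNReal, ENNReal.coe_toNNReal_eq_toReal] using this)
  have hint : Integrable z μ := (Lp.memLp z).integrable (by norm_num)
  refine ⟨z, hint, fun t ht => ?_, ?_⟩
  · rw [← sub_eq_iff_eq_add', intervalIntegral.integral_of_le ht.1]
    refine ext_inner_right ℝ fun w => ?_
    have hms : MeasurableSet (Ioc 0 t) := measurableSet_Ioc
    have hr : μ.restrict (Ioc 0 t) = volume.restrict (Ioc 0 t) := by
      rw [hμ, Measure.restrict_restrict hms, inter_eq_left.2 (Ioc_subset_Ioc_right ht.2)]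
    have hsi : ∀ f : Lp X 2 μ, ⟪f, indicatorConstLp 2 hms (measure_ne_top μ _) w⟫ 
        = ⟪∫ r in Ioc 0 t, f r, w⟫ := fun f => by
      rw [real_inner_comm, L2.inner_indicatorConstLp_eq_inner_setIntegral, real_inner_comm, hr]
    rw [← hsi]
    refine (hzl _ _ ?_).symm
    have hq : ∀ n : ℕ, ⟪(hqL n).toLp (q n), indicatorConstLp 2 hms (measure_ne_top μ _) w⟫ =
        ⟪((n:ℝ)+1) • ((∫ r in t..(t + ((n:ℝ)+1)⁻¹), k r) - ∫ r in 0..(0 + ((n:ℝ)+1)⁻¹), k r), w⟫ := by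
      intro n
      rw [hsi]
      congr 1
      have h1 : ∫ r in Ioc 0 t, (hqL n).toLp (q n) r = ∫ r in Ioc 0 t, q n r := by
        refine integral_congr_ae ?_
        rw [← hr]
        exact ae_restrict_of_ae (hqL n).coeFn_toLp
      rw [h1, ← intervalIntegral.integral_of_le ht.1]
      have hi : ∀ a b, IntervalIntegrable k volume a b := fun a b => hk.continuous.intervalIntegrable a b
      have hi' : ∀ a b, IntervalIntegrable (fun r => k (r + ((n:ℝ)+1)⁻¹)) volume a b := fun a b =>
        (hk.continuous.comp (continuous_id.add continuous_const)).intervalIntegrable a b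
      simp only [q]
      rw [intervalIntegral.integral_smul, intervalIntegral.integral_sub (hi' _ _) (hi _ _),
        intervalIntegral.integral_comp_add_right (fun r => k r),
        intervalIntegral.integral_interval_sub_interval_comm (hi _ _) (hi _ _) (hi _ _),
        intervalIntegral.integral_symm t, intervalIntegral.integral_symm _ (0 + ((n:ℝ)+1)⁻¹)]
      congr 1
      abel
    have hlim : ∀ a : ℝ, Tendsto (fun n : ℕ => ((n:ℝ)+1) • ∫ r in a..(a + ((n:ℝ)+1)⁻¹), k r)
        atTop (𝓝 (k a)) := by
      intro a
      have hd : HasDerivAt (fun b => ∫ r in a..b, k r) (k a) a :=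
        (hk.continuous.integral_hasStrictDerivAt a a).hasDerivAt
      have h0 : Tendsto (fun n : ℕ => ((n:ℝ)+1)⁻¹) atTop (𝓝[≠] 0) := by
        refine tendsto_nhdsWithin_iff.2 ⟨?_, Eventually.of_forall fun n => ?_⟩
        · simpa using tendsto_one_div_add_atTop_nhds_zero_nat (𝕜 := ℝ)
        · have : ((n:ℝ)+1) ≠ 0 := by positivity
          simpa using this
      have := (hasDerivAt_iff_tendsto_slope_zero.1 hd).comp h0
      simpa [Function.comp_def] using this
    simp only [hq, smul_sub]
    exact ((hlim t).sub (hlim 0)).inner tendsto_const_nhds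
  · have h1 := eLpNorm_le_eLpNorm_mul_rpow_measure_univ (μ := μ) (p := 1) (q := 2) (f := z)
      (by norm_num) (Lp.aestronglyMeasurable z)
    have h2 : ∫ r, ‖z r‖ ∂μ = (eLpNorm z 1 μ).toReal := by
      rw [integral_norm_eq_lintegral_enorm (Lp.aestronglyMeasurable z), eLpNorm_one_eq_lintegral_enorm]
    have h3 := ENNReal.toReal_mono (ENNReal.mul_ne_top (Lp.eLpNorm_ne_top z) (by
      refine ENNReal.rpow_ne_top_of_nonneg (by norm_num) (measure_ne_top μ _))) h1
    rw [← h2, ENNReal.toReal_mul, ← Lp.norm_def] at h3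
    refine h3.trans ?_
    have h4 : (μ univ ^ (1 / (1:ℝ≥0∞).toReal - 1 / (2:ℝ≥0∞).toReal)).toReal = T ^ ((2:ℝ)⁻¹) := by
      rw [← ENNReal.toReal_rpow]
      norm_num [hμ, hT]
    rw [h4]
    calc _ ≤ T ^ ((2:ℝ)⁻¹) * C * T ^ ((2:ℝ)⁻¹) := by gcongr
      _ = C * (T ^ ((2:ℝ)⁻¹)) ^ 2 := by ring
      _ = C * T := by rw [← Real.rpow_natCast, ← Real.rpow_mul hT]; norm_num

/-- A linear relation `Γ` (the graph of an operator) on a Hilbert space that is quasi-dissipative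
with bound `ω` and satisfies the range condition for all large parameters. -/
structure IsQuasiMaxDissipative {X : Type*} [NormedAddCommGroup X] [InnerProductSpace ℝ X]
    (Γ : Submodule ℝ (X × X)) (ω : ℝ) : Prop where
  nonneg : 0 ≤ ω
  inner_le : ∀ p q, (p, q) ∈ Γ → ⟪p, q⟫ ≤ ω * ‖p‖ ^ 2
  surj : ∃ l₀ : ℝ, ∀ l ≥ l₀, ∀ z, ∃ p q, (p, q) ∈ Γ ∧ l • p - q = z
  eq_zero : ∀ q, ((0 : X), q) ∈ Γ → q = 0

namespace IsQuasiMaxDissipative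

variable {X : Type*} [NormedAddCommGroup X] [InnerProductSpace ℝ X] {Γ : Submodule ℝ (X × X)}
  {ω : ℝ}

theorem norm_le (h : IsQuasiMaxDissipative Γ ω) {l : ℝ} (hl : 2 * ω ≤ l) (hl0 : 0 < l) {p q : X}
    (hpq : (p, q) ∈ Γ) : ‖p‖ ≤ 2 / l * ‖l • p - q‖ := by
  have h1 := h.inner_le p q hpq
  have h2 := real_inner_le_norm p (l • p - q)
  rw [inner_sub_right, real_inner_smul_right, real_inner_self_eq_norm_sq] at h2
  rw [div_mul_eq_mul_div, le_div_iff₀ hl0]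
  rcases (norm_nonneg p).eq_or_lt with h0 | h0
  · rw [← h0]; simp
  · have : ‖p‖ * (‖p‖ * l) ≤ ‖p‖ * (2 * ‖l • p - q‖) := by
      nlinarith [mul_nonneg (sub_nonneg.2 hl) (sq_nonneg ‖p‖)]
    exact le_of_mul_le_mul_left this h0

theorem exists_resolvent (h : IsQuasiMaxDissipative Γ ω) : ∃ l₀ : ℝ, 1 ≤ l₀ ∧ ∀ l ≥ l₀,
    ∃ R : X →L[ℝ] X, (∀ p q, (p, q) ∈ Γ ↔ R (l • p - q) = p) ∧ ∀ z, ‖R z‖ ≤ 2 / l * ‖z‖ := by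
  obtain ⟨l₁, hl₁⟩ := h.surj
  refine ⟨max (max l₁ (2 * ω)) 1, le_max_right _ _, fun l hl => ?_⟩
  have hl1 : l₁ ≤ l := (le_max_left _ _).trans ((le_max_left _ _).trans hl)
  have hl2 : 2 * ω ≤ l := (le_max_right _ _).trans ((le_max_left _ _).trans hl)
  have hl0 : 0 < l := zero_lt_one.trans_le ((le_max_right _ _).trans hl)
  choose p q hpq hz using hl₁ l hl1
  have huniq : ∀ p₁ q₁ p₂ q₂, (p₁, q₁) ∈ Γ → (p₂, q₂) ∈ Γ → l • p₁ - q₁ = l • p₂ - q₂ →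
      p₁ = p₂ := fun p₁ q₁ p₂ q₂ h₁ h₂ he => by
    have h3 := h.norm_le hl2 hl0 (Γ.sub_mem h₁ h₂)
    have h4 : l • (p₁ - p₂) - (q₁ - q₂) = 0 := by
      rw [smul_sub, sub_sub_sub_comm, he, sub_self]
    rw [h4, norm_zero, mul_zero] at h3
    exact sub_eq_zero.1 (norm_le_zero_iff.1 h3)
  let R : X →ₗ[ℝ] X :=
    { toFun := p
      map_add' := fun a c => huniq _ (q (a + c)) _ (q a + q c) (hpq _)
        (Γ.add_mem (hpq a) (hpq c)) (by
          rw [hz, smul_add, add_sub_add_comm, hz, hz])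
      map_smul' := fun r a => huniq _ (q (r • a)) _ (r • q a) (hpq _)
        (Γ.smul_mem r (hpq a)) (by
          rw [hz, RingHom.id_apply, smul_comm, ← smul_sub, hz]) }
  have hb : ∀ z, ‖R z‖ ≤ 2 / l * ‖z‖ := fun z => by
    have := h.norm_le hl2 hl0 (hpq z)
    rwa [hz] at this
  refine ⟨R.mkContinuous _ hb, fun a c => ⟨fun hac => ?_, fun hac => ?_⟩, hb⟩
  · exact huniq _ (q (l • a - c)) _ c (hpq _) hac (hz _)
  · have h1 := hpq (l • a - c)
    have h2 := hz (l • a - c)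
    have h3 : p (l • a - c) = a := hac
    rw [h3] at h1 h2
    rwa [sub_right_inj.1 h2] at h1

theorem isClosed (h : IsQuasiMaxDissipative Γ ω) : IsClosed (Γ : Set (X × X)) := by
  obtain ⟨l, -, hl⟩ := h.exists_resolvent
  obtain ⟨R, hR, -⟩ := hl l le_rfl
  have : (Γ : Set (X × X)) = {x | R (l • x.1 - x.2) = x.1} := by
    ext x; exact hR x.1 x.2
  rw [this]
  exact isClosed_eq (by fun_prop) (by fun_prop)

open MeasureTheory in
theorem integral_mem [CompleteSpace X] (h : IsQuasiMaxDissipative Γ ω) {α : Type*}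
    [MeasurableSpace α] {μ : Measure α} {p q : α → X} (hp : Integrable p μ) (hq : Integrable q μ)
    (hpq : ∀ᵐ a ∂μ, (p a, q a) ∈ Γ) : (∫ a, p a ∂μ, ∫ a, q a ∂μ) ∈ Γ := by
  obtain ⟨l, -, hl⟩ := h.exists_resolvent
  obtain ⟨R, hR, -⟩ := hl l le_rfl
  have hi : ∫ a, (l • p a - q a) ∂μ = l • ∫ a, p a ∂μ - ∫ a, q a ∂μ := by
    rw [← integral_smul]
    exact integral_sub (hp.smul l) hq
  have hint : Integrable (fun a => l • p a - q a) μ := (hp.smul l).sub hq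
  rw [hR, ← hi, ← R.integral_comp_comm hint]
  exact integral_congr_ae (hpq.mono fun a ha => (hR _ _).1 ha)

theorem dense_domain [CompleteSpace X] (h : IsQuasiMaxDissipative Γ ω) (z : X) {ε : ℝ}
    (hε : 0 < ε) : ∃ p q, (p, q) ∈ Γ ∧ ‖z - p‖ < ε := by
  have hd : (Γ.map (LinearMap.fst ℝ X X)).topologicalClosure = ⊤ := by
    rw [Submodule.topologicalClosure_eq_top_iff, Submodule.eq_bot_iff]
    intro z hz
    obtain ⟨l₁, hl₁⟩ := h.surj
    obtain ⟨p, q, hpq, rfl⟩ := hl₁ (max l₁ (ω + 1)) (le_max_left _ _) z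
    have h1 := hz p ⟨(p, q), hpq, rfl⟩
    rw [inner_sub_right, real_inner_smul_right, real_inner_self_eq_norm_sq] at h1
    have h2 := h.inner_le p q hpq
    have h3 : (ω + 1) * ‖p‖ ^ 2 ≤ max l₁ (ω + 1) * ‖p‖ ^ 2 := by gcongr; exact le_max_right _ _
    have h4 : p = 0 := by
      have : ‖p‖ ^ 2 ≤ 0 := by linarith
      simpa using this
    rw [h4] at hpq
    rw [h4, h.eq_zero q hpq, smul_zero, sub_zero]
  have hz : z ∈ closure ((Γ.map (LinearMap.fst ℝ X X) : Submodule ℝ X) : Set X) := by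
    rw [← Submodule.topologicalClosure_coe, hd]; trivial
  obtain ⟨_, ⟨⟨p, q⟩, hpq, rfl⟩, hd⟩ := Metric.mem_closure_iff.1 hz ε hε
  exact ⟨p, q, hpq, by simpa [dist_eq_norm] using hd⟩

open Filter Topology in
theorem exists_yosida [CompleteSpace X] (h : IsQuasiMaxDissipative Γ ω) :
    ∃ A J : ℕ → X →L[ℝ] X, (∀ n z, (J n z, A n z) ∈ Γ) ∧ (∀ n z, ‖J n z‖ ≤ 2 * ‖z‖) ∧
      (∀ z, Tendsto (fun n => J n z) atTop (𝓝 z)) ∧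
      (∀ p q, (p, q) ∈ Γ → Tendsto (fun n => A n p) atTop (𝓝 q)) ∧
      (∀ n z, ⟪z, A n z⟫ ≤ 4 * ω * ‖z‖ ^ 2) ∧ ∀ m n, Commute (A m) (A n) := by
  obtain ⟨l₀, hl₀, hl⟩ := h.exists_resolvent
  choose! R hR hRb using hl
  have hn : ∀ n : ℕ, l₀ ≤ l₀ + n := fun n => by simp
  have hpos : ∀ n : ℕ, 0 < l₀ + n := fun n => by linarith [hn n]
  let J : ℕ → X →L[ℝ] X := fun n => (l₀ + n) • R (l₀ + n)
  let A : ℕ → X →L[ℝ] X := fun n => (l₀ + n) • (J n - 1)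
  have hJA : ∀ n z, (J n z, A n z) ∈ Γ := fun n z => by
    have h1 : (R (l₀ + n) z, (l₀ + n) • R (l₀ + n) z - z) ∈ Γ := by
      rw [hR _ (hn n), sub_sub_cancel]
    exact Γ.smul_mem (l₀ + n) h1
  have hJb : ∀ n z, ‖J n z‖ ≤ 2 * ‖z‖ := fun n z => by
    have := hRb _ (hn n) z
    change ‖(l₀ + n) • R (l₀ + n) z‖ ≤ _
    rw [norm_smul, Real.norm_of_nonneg (hpos n).le]
    calc _ ≤ (l₀ + n) * (2 / (l₀ + n) * ‖z‖) := by have := hpos n; gcongr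
      _ = 2 * ‖z‖ := by have := (hpos n).ne'; field_simp
  have hJD : ∀ n p q, (p, q) ∈ Γ → J n p = p + R (l₀ + n) q := fun n p q hpq => by
    have h1 := (hR _ (hn n) p q).1 hpq
    rw [map_sub, map_smul] at h1
    change (l₀ + n) • R (l₀ + n) p = _
    rw [← sub_eq_iff_eq_add, h1]
  have hJt : ∀ z, Tendsto (fun n => J n z) atTop (𝓝 z) := by
    intro z
    rw [Metric.tendsto_atTop]
    intro ε hε
    obtain ⟨p, q, hpq, hzp⟩ := h.dense_domain z (ε := ε / 6) (by positivity)
    have ht : Tendsto (fun n : ℕ => 2 / (l₀ + n) * ‖q‖) atTop (𝓝 0) := by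
      have : Tendsto (fun n : ℕ => l₀ + (n : ℝ)) atTop atTop :=
        tendsto_atTop_add_const_left _ _ tendsto_natCast_atTop_atTop
      simpa using (this.const_div_atTop 2).mul_const ‖q‖
    obtain ⟨N, hN⟩ := (Metric.tendsto_atTop.1 ht) (ε / 2) (by positivity)
    refine ⟨N, fun n hnN => ?_⟩
    have h1 := hN n hnN
    rw [Real.dist_eq, sub_zero] at h1
    have h2 : J n z - z = J n (z - p) - (z - p) + R (l₀ + n) q := by
      rw [map_sub, hJD n p q hpq]; abel
    rw [dist_eq_norm, h2]
    calc _ ≤ ‖J n (z - p)‖ + ‖z - p‖ + ‖R (l₀ + n) q‖ :=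
          (norm_add_le _ _).trans (by gcongr; exact norm_sub_le _ _)
      _ ≤ 2 * ‖z - p‖ + ‖z - p‖ + 2 / (l₀ + n) * ‖q‖ := by
          gcongr
          · exact hJb n _
          · exact hRb _ (hn n) q
      _ < ε := by linarith [(le_abs_self _).trans_lt h1]
  refine ⟨A, J, hJA, hJb, hJt, fun p q hpq => ?_, fun n z => ?_, fun m n => ?_⟩
  · refine (hJt q).congr fun n => ?_
    change J n q = (l₀ + n) • (J n p - p)
    rw [hJD n p q hpq, add_sub_cancel_left]
    rfl
  · have h1 := h.inner_le _ _ (hJA n z)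
    have h2 : A n z = (l₀ + n) • (J n z - z) := rfl
    have h3 : ⟪J n z, A n z⟫ = ⟪z, A n z⟫ + (l₀ + n) * ‖J n z - z‖ ^ 2 := by
      rw [← sub_eq_iff_eq_add', ← inner_sub_left, h2, real_inner_smul_right,
        real_inner_self_eq_norm_sq]
    have h4 : ‖J n z‖ ^ 2 ≤ (2 * ‖z‖) ^ 2 := by gcongr; exact hJb n z
    have h5 := mul_nonneg (hpos n).le (sq_nonneg ‖J n z - z‖)
    nlinarith [mul_le_mul_of_nonneg_left h4 h.nonneg]
  · have hid : ∀ m n : ℕ, ∀ z, R (l₀ + m) z =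
        R (l₀ + n) z + ((l₀ + n) - (l₀ + m)) • R (l₀ + n) (R (l₀ + m) z) := fun m n z => by
      have h1 : (R (l₀ + m) z, (l₀ + m) • R (l₀ + m) z - z) ∈ Γ := by
        rw [hR _ (hn m), sub_sub_cancel]
      have h2 := (hR _ (hn n) _ _).1 h1
      nth_rw 1 [← h2]
      simp only [map_sub, map_smul, sub_smul]
      abel
    have hRc : Commute (R (l₀ + m)) (R (l₀ + n)) := by
      by_cases hmn : m = n
      · rw [hmn]
      · ext z
        change R (l₀ + m) (R (l₀ + n) z) = R (l₀ + n) (R (l₀ + m) z)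
        have hne : ((l₀ + n) - (l₀ + m) : ℝ) ≠ 0 := by
          rw [add_sub_add_left_eq_sub, sub_ne_zero]
          exact_mod_cast Ne.symm hmn
        have h1 := hid m n z
        rw [hid n m z, add_assoc, left_eq_add, ← neg_sub, neg_smul, neg_add_eq_zero] at h1
        exact smul_right_injective X hne h1
    have hJc : Commute (J m) (J n) := (hRc.smul_left _).smul_right _
    exact ((((hJc.sub_right (Commute.one_right _)).sub_left
      ((Commute.one_left _).sub_right (Commute.one_left _)))).smul_left _).smul_right _

open Filter Topology in
/-- A family of evolution operators on a short interval, obtained from the exponentials of the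
Yosida approximations; outside of `[0, τ]` the family is extended by constants. -/
theorem exists_semigroup [CompleteSpace X] (h : IsQuasiMaxDissipative Γ ω) {τ : ℝ} (hτ : 0 < τ)
    (hτω : (8 * ω + 1) * τ ≤ 1) :
    ∃ S : ℝ → X →L[ℝ] X, (∀ z, Continuous fun t => S t z) ∧ (∀ t z, ‖S t z‖ ≤ 2 * ‖z‖) ∧
      ∀ t ∈ Icc 0 τ, ∀ z, (∫ r in (0:ℝ)..t, S r z, S t z - z) ∈ Γ := by
  obtain ⟨A, J, hJA, hJb, hJ, hA, hAi, hAc⟩ := h.exists_yosida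
  have hω := h.nonneg
  have hτ1 : τ ≤ 1 := by nlinarith
  let c : ℝ → ℝ := fun t => max 0 (min t τ)
  have hc : ∀ t, c t ∈ Icc 0 τ := fun t => ⟨le_max_left _ _, max_le hτ.le (min_le_right _ _)⟩
  have hcc : Continuous c := by fun_prop
  have hci : ∀ t ∈ Icc 0 τ, c t = t := fun t ht => by simp [c, ht.1, ht.2]
  let E : ℕ → ℝ → X →L[ℝ] X := fun n t => NormedSpace.exp (t • A n)
  have hEd : ∀ n z t, HasDerivAt (fun t => E n t z) (A n (E n t z)) t := fun n z t =>
    (hasDerivAt_exp_smul_const' (𝕂 := ℝ) (A n) t).clm_apply (hasDerivAt_const t z) |>.congr_deriv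
      (by simp [E])
  have hE0 : ∀ n z, E n 0 z = z := fun n z => by simp [E]
  have hEc : ∀ m n t z, A n (E m t z) = E m t (A n z) := fun m n t z => by
    have : Commute (A n) (E m t) := ((hAc n m).smul_right t).exp_right
    exact congrArg (fun B : X →L[ℝ] X => B z) this.eq
  have hEb : ∀ n, ∀ t ∈ Icc 0 τ, ∀ z, ‖E n t z‖ ≤ 2 * ‖z‖ := fun n t ht z => by
    have := sq_norm_le_of_dissipative (x := fun t => E n t z) (K := 8 * ω + 1) (ε := 0)
      (by positivity) hτω le_rfl (fun t _ => (hEd n z t).hasDerivWithinAt)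
      (fun t _ => by nlinarith [hAi n (E n t z), sq_nonneg ‖E n t z‖]) t ht
    simp only [hE0] at this
    refine le_of_sq_le_sq ?_ (by positivity)
    nlinarith [sq_nonneg ‖z‖]
  have hdiff : ∀ m n, ∀ t ∈ Icc 0 τ, ∀ z, ‖E n t z - E m t z‖ ≤ 3 * ‖A n z - A m z‖ := by
    intro m n t ht z
    have := sq_norm_le_of_dissipative (x := fun t => E n t z - E m t z) (K := 8 * ω + 1)
      (x' := fun t => A n (E n t z) - A m (E m t z)) (ε := 4 * ‖A n z - A m z‖ ^ 2)
      (by positivity) hτω (by positivity)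
      (fun t _ => ((hEd n z t).sub (hEd m z t)).hasDerivWithinAt)
      (fun t ht => by
        have h1 : A n (E n t z) - A m (E m t z) =
            A n (E n t z - E m t z) + E m t (A n z - A m z) := by
          simp only [map_sub, hEc]; abel
        rw [h1, inner_add_right]
        have h2 := hAi n (E n t z - E m t z)
        have h3 := real_inner_le_norm (E n t z - E m t z) (E m t (A n z - A m z))
        have h4 := hEb m t ht (A n z - A m z)
        have h5 := mul_le_mul_of_nonneg_left h4 (norm_nonneg (E n t z - E m t z))
        nlinarith [sq_nonneg (‖E n t z - E m t z‖ - 2 * ‖A n z - A m z‖)]) t ht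
    simp only [hE0, sub_self, norm_zero] at this
    refine le_of_sq_le_sq ?_ (by positivity)
    have ht1 : t ≤ 1 := ht.2.trans hτ1
    nlinarith [mul_le_mul_of_nonneg_left ht1 (sq_nonneg ‖A n z - A m z‖),
      sq_nonneg ‖A n z - A m z‖]
  have hcau : ∀ z, UniformCauchySeqOn (fun n t => E n (c t) z) atTop univ := by
    intro z
    rw [Metric.uniformCauchySeqOn_iff]
    intro ε hε
    obtain ⟨p, q, hpq, hzp⟩ := h.dense_domain z (ε := ε / 8) (by positivity)
    obtain ⟨N, hN⟩ := Metric.cauchySeq_iff.1 (hA p q hpq).cauchySeq (ε / 6) (by positivity)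
    refine ⟨N, fun m hm n hn t _ => ?_⟩
    have h1 : E m (c t) z - E n (c t) z = E m (c t) (z - p) - E n (c t) (z - p) +
        (E m (c t) p - E n (c t) p) := by simp only [map_sub]; abel
    have h2 := hN m hm n hn
    rw [dist_eq_norm] at h2 ⊢
    rw [h1]
    calc _ ≤ ‖E m (c t) (z - p)‖ + ‖E n (c t) (z - p)‖ + ‖E m (c t) p - E n (c t) p‖ :=
          (norm_add_le _ _).trans (by gcongr; exact norm_sub_le _ _)
      _ ≤ 2 * ‖z - p‖ + 2 * ‖z - p‖ + 3 * ‖A m p - A n p‖ := by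
          gcongr
          · exact hEb m _ (hc t) _
          · exact hEb n _ (hc t) _
          · exact hdiff n m _ (hc t) p
      _ < ε := by linarith
  choose s hs using fun t z => cauchySeq_tendsto_of_complete ((hcau z).cauchySeq (mem_univ t))
  have hunif : ∀ z, TendstoUniformlyOn (fun n t => E n (c t) z) (fun t => s t z) atTop univ :=
    fun z => (hcau z).tendstoUniformlyOn_of_tendsto fun t _ => hs t z
  have hsb : ∀ t z, ‖s t z‖ ≤ 2 * ‖z‖ := fun t z =>
    le_of_tendsto (hs t z).norm (Eventually.of_forall fun n => hEb n _ (hc t) z)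
  have hEcont : ∀ n z, Continuous fun t => E n (c t) z := fun n z =>
    (continuous_iff_continuousAt.2 fun t => (hEd n z t).continuousAt).comp hcc
  let S : ℝ → X →L[ℝ] X := fun t => LinearMap.mkContinuous
    { toFun := s t
      map_add' := fun a b => tendsto_nhds_unique (hs t (a + b)) (by
        simpa using (hs t a).add (hs t b))
      map_smul' := fun r a => tendsto_nhds_unique (hs t (r • a)) (by
        simpa using (hs t a).const_smul r) } 2 (hsb t)
  have hSs : ∀ t z, S t z = s t z := fun t z => rfl
  refine ⟨S, fun z => ?_, hsb, fun t ht z => ?_⟩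
  · exact continuousOn_univ.1 ((hunif z).continuousOn
      (Frequently.of_forall fun n => (hEcont n z).continuousOn))
  · have hI : ∀ n, A n (∫ r in (0:ℝ)..t, E n (c r) z) = E n (c t) z - z := fun n => by
      have h1 : ∫ r in (0:ℝ)..t, E n (c r) z = ∫ r in (0:ℝ)..t, E n r z :=
        intervalIntegral.integral_congr fun r hr => by
          rw [uIcc_of_le ht.1] at hr
          simp only [hci r ⟨hr.1, hr.2.trans ht.2⟩]
      have hEn : Continuous fun r => E n r z :=
        continuous_iff_continuousAt.2 fun t => (hEd n z t).continuousAt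
      have h2 := intervalIntegral.integral_eq_sub_of_hasDerivAt (a := 0) (b := t)
        (fun r _ => hEd n z r) (((A n).continuous.comp hEn).intervalIntegrable _ _)
      rw [h1, hci t ht, ← (A n).intervalIntegral_comp_comm (hEn.intervalIntegrable _ _), h2, hE0]
    have hv : Tendsto (fun n => ∫ r in (0:ℝ)..t, E n (c r) z) atTop
        (𝓝 (∫ r in (0:ℝ)..t, S r z)) := by
      refine intervalIntegral.tendsto_integral_filter_of_dominated_convergence
        (fun _ => 2 * ‖z‖) ?_ ?_ intervalIntegrable_const ?_
      · exact Eventually.of_forall fun n => (hEcont n z).aestronglyMeasurable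
      · exact Eventually.of_forall fun n => Eventually.of_forall fun r _ => hEb n _ (hc r) z
      · exact Eventually.of_forall fun r _ => hs r z
    have hJv : Tendsto (fun n => J n (∫ r in (0:ℝ)..t, E n (c r) z)) atTop
        (𝓝 (∫ r in (0:ℝ)..t, S r z)) := by
      set v := ∫ r in (0:ℝ)..t, S r z
      have h1 : Tendsto (fun n => J n ((∫ r in (0:ℝ)..t, E n (c r) z) - v)) atTop (𝓝 0) := by
        refine squeeze_zero_norm (fun n => hJb n _) ?_
        have := ((hv.sub_const v).norm).const_mul 2
        simpa using this
      simpa using h1.add (hJ v)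
    exact h.isClosed.mem_of_tendsto (hJv.prodMk_nhds ((hs t z).sub_const z))
      (Eventually.of_forall fun n => by
        have := hJA n (∫ r in (0:ℝ)..t, E n (c r) z)
        rwa [hI n] at this)

open MeasureTheory Filter Topology in
/-- Classical solvability of the inhomogeneous linear Cauchy problem. -/
theorem exists_linear_solution [CompleteSpace X] (h : IsQuasiMaxDissipative Γ ω) {T : ℝ}
    (hT : 0 < T) (hTω : (8 * ω + 1) * T ≤ 1) {k k' : ℝ → X} (hk' : IntegrableOn k' (Ioc 0 T))
    (hk : ∀ t ∈ Icc 0 T, k t = k 0 + ∫ s in (0:ℝ)..t, k' s) {x₀ y₀ : X} (hx₀ : (x₀, y₀) ∈ Γ) :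
    ∃ x x' : ℝ → X, x 0 = x₀ ∧ (∀ t, HasDerivAt x (x' t) t) ∧ Continuous x' ∧
      (∀ t ∈ Icc 0 T, (x t, x' t - k t) ∈ Γ) ∧
      ∀ t, ‖x' t‖ ≤ 2 * (‖y₀ + k 0‖ + ∫ s in Ioc 0 T, ‖k' s‖) := by
  obtain ⟨S, hSc, hSb, hSΓ⟩ := h.exists_semigroup hT hTω
  set μ : Measure ℝ := volume.restrict (Ioc 0 T) with hμ
  have hk'm : AEStronglyMeasurable k' μ := hk'.aestronglyMeasurable
  have hSj : Continuous fun p : ℝ × X => S p.1 p.2 := by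
    refine continuous_prod_of_continuous_lipschitzWith' _ 2 (fun t => ?_) hSc
    refine LipschitzWith.of_dist_le_mul fun a b => ?_
    rw [dist_eq_norm, dist_eq_norm, ← map_sub]
    exact hSb t _
  let P : ℝ → X → X := fun t z => ∫ r in (0:ℝ)..(max t 0), S r z
  have hPj : Continuous fun p : ℝ × X => P p.1 p.2 := by
    refine intervalIntegral.continuous_parametric_intervalIntegral_of_continuous
      (f := fun (p : ℝ × X) r => S r p.2) (s := fun p => max p.1 0) ?_ (by fun_prop)
    exact hSj.comp (continuous_snd.prodMk (continuous_snd.comp continuous_fst))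
  have hPl : ∀ a b z, ‖P a z - P b z‖ ≤ 2 * ‖z‖ * |a - b| := fun a b z => by
    have hi : ∀ a b, IntervalIntegrable (fun r => S r z) volume a b := fun a b =>
      (hSc z).intervalIntegrable a b
    simp only [P]
    rw [intervalIntegral.integral_interval_sub_left (hi _ _) (hi _ _)]
    refine (intervalIntegral.norm_integral_le_of_norm_le_const fun r _ => hSb r z).trans ?_
    exact mul_le_mul_of_nonneg_left (abs_max_sub_max_le_abs a b 0) (by positivity)
  have hP0 : ∀ t ≤ 0, ∀ z, P t z = 0 := fun t ht z => by simp [P, max_eq_right ht]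
  have hPb : ∀ t z, ‖P t z‖ ≤ 2 * ‖z‖ * |t| := fun t z => by
    have := hPl t 0 z
    rwa [hP0 0 le_rfl, sub_zero, sub_zero] at this
  let Q : ℝ → ℝ → X := fun t => (Iio t).indicator fun s => S (t - s) (k' s)
  have hQm : ∀ t, AEStronglyMeasurable (Q t) μ := fun t => by
    refine AEStronglyMeasurable.indicator ?_ measurableSet_Iio
    exact hSj.comp_aestronglyMeasurable
      ((continuous_const.sub continuous_id).aestronglyMeasurable.prodMk hk'm)
  have hQb : ∀ t s, ‖Q t s‖ ≤ 2 * ‖k' s‖ := fun t s => by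
    refine (norm_indicator_le_norm_self _ _).trans (hSb _ _)
  have hbi : Integrable (fun s => 2 * ‖k' s‖) μ := hk'.norm.const_mul 2
  have hQi : ∀ t, Integrable (Q t) μ := fun t =>
    hbi.mono' (hQm t) (Eventually.of_forall fun s => hQb t s)
  have hPm : ∀ t, AEStronglyMeasurable (fun s => P (t - s) (k' s)) μ := fun t =>
    hPj.comp_aestronglyMeasurable
      ((continuous_const.sub continuous_id).aestronglyMeasurable.prodMk hk'm)
  have hPi : ∀ t, Integrable (fun s => P (t - s) (k' s)) μ := fun t => by
    refine (hbi.mul_const (|t| + T)).mono' (hPm t) ?_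
    refine ae_restrict_of_forall_mem measurableSet_Ioc fun s hs => (hPb _ _).trans ?_
    gcongr
    refine (norm_sub_le t s).trans ?_
    rw [Real.norm_eq_abs, Real.norm_of_nonneg hs.1.le]
    linarith [hs.2]
  have hne : ∀ t : ℝ, ∀ᵐ s ∂μ, s ≠ t := fun t =>
    ae_restrict_of_ae (Measure.ae_ne volume t)
  have hVd : ∀ t, HasDerivAt (fun t => ∫ s, P (t - s) (k' s) ∂μ) (∫ s, Q t s ∂μ) t := fun t => by
    refine (hasDerivAt_integral_of_dominated_loc_of_lip (s := univ)
      (bound := fun s => 2 * ‖k' s‖) univ_mem (Eventually.of_forall hPm) (hPi t) (hQm t) ?_ hbi ?_).2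
    · refine Eventually.of_forall fun s => LipschitzOnWith.of_dist_le_mul fun a _ b _ => ?_
      rw [dist_eq_norm, Real.dist_eq]
      refine (hPl _ _ _).trans_eq ?_
      rw [sub_sub_sub_cancel_right]
      simp
    · refine (hne t).mono fun s hs => ?_
      rcases lt_or_gt_of_ne hs with hst | hst
      · have h1 : HasDerivAt (fun b => ∫ r in (0:ℝ)..b, S r (k' s)) (S (t - s) (k' s)) (t - s) :=
          ((hSc (k' s)).integral_hasStrictDerivAt 0 (t - s)).hasDerivAt
        have h2 : Q t s = S (t - s) (k' s) := indicator_of_mem (s := Iio t) hst _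
        rw [h2]
        refine (h1.comp_sub_const t s).congr_of_eventuallyEq ?_
        filter_upwards [lt_mem_nhds hst] with a ha
        simp only [P]
        rw [max_eq_left (sub_pos.2 ha).le]
      · have h2 : Q t s = 0 := indicator_of_notMem (s := Iio t) (not_lt.2 hst.le) _
        rw [h2]
        refine (hasDerivAt_const t (0 : X)).congr_of_eventuallyEq ?_
        filter_upwards [gt_mem_nhds hst] with a ha
        exact hP0 _ (sub_neg.2 ha).le _
  have hQc : Continuous fun t => ∫ s, Q t s ∂μ := by
    refine continuous_iff_continuousAt.2 fun t => ?_
    refine continuousAt_of_dominated (Eventually.of_forall hQm)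
      (Eventually.of_forall fun t => Eventually.of_forall (hQb t)) hbi ((hne t).mono fun s hs => ?_)
    rcases lt_or_gt_of_ne hs with hst | hst
    · have h1 : ContinuousAt (fun t => S (t - s) (k' s)) t :=
        ((hSc (k' s)).comp (continuous_id.sub continuous_const)).continuousAt
      refine h1.congr ?_
      filter_upwards [lt_mem_nhds hst] with a ha
      exact (indicator_of_mem (s := Iio a) ha fun s => S (a - s) (k' s)).symm
    · refine (continuousAt_const (y := (0 : X))).congr ?_
      filter_upwards [gt_mem_nhds hst] with a ha
      exact (indicator_of_notMem (s := Iio a) (not_lt.2 ha.le) fun s => S (a - s) (k' s)).symm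
  set η := y₀ + k 0 with hη
  refine ⟨fun t => x₀ + (∫ r in (0:ℝ)..t, S r η) + ∫ s, P (t - s) (k' s) ∂μ,
    fun t => S t η + ∫ s, Q t s ∂μ, ?_, fun t => ?_, (hSc η).add hQc, fun t ht => ?_, fun t => ?_⟩
  · have : ∫ s, P (0 - s) (k' s) ∂μ = 0 := by
      refine integral_eq_zero_of_ae (ae_restrict_of_forall_mem measurableSet_Ioc fun s hs => ?_)
      exact hP0 _ (by linarith [hs.1]) _
    simpa using this
  · exact ((((hSc η).integral_hasStrictDerivAt 0 t).hasDerivAt).const_add x₀).add (hVd t)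
  · have hind : Integrable ((Iio t).indicator k') μ := hk'.indicator measurableSet_Iio
    have h1 : (∫ s, P (t - s) (k' s) ∂μ, ∫ s, (Q t s - (Iio t).indicator k' s) ∂μ) ∈ Γ := by
      refine h.integral_mem (hPi t) ((hQi t).sub hind)
        (ae_restrict_of_forall_mem measurableSet_Ioc fun s hs => ?_)
      by_cases hst : s < t
      · have h2 := hSΓ (t - s) ⟨(sub_pos.2 hst).le, by linarith [hs.1, ht.2]⟩ (k' s)
        simpa [P, Q, indicator_of_mem (s := Iio t) hst, max_eq_left (sub_pos.2 hst).le] using h2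
      · have h3 : s ∉ Iio t := hst
        rw [hP0 _ (by linarith)]
        simp only [Q, indicator_of_notMem h3, sub_zero]
        exact Γ.zero_mem
    have h2 : ∫ s, (Q t s - (Iio t).indicator k' s) ∂μ = (∫ s, Q t s ∂μ) - (k t - k 0) := by
      have h3 : ∫ s, (Iio t).indicator k' s ∂μ = ∫ s in (0:ℝ)..t, k' s := by
        have h4 : Ioc 0 T ∩ Iio t = Ioo 0 t := by
          ext s
          exact ⟨fun h => ⟨h.1.1, h.2⟩, fun h => ⟨⟨h.1, h.2.le.trans ht.2⟩, h.2⟩⟩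
        rw [hμ, setIntegral_indicator measurableSet_Iio, intervalIntegral.integral_of_le ht.1,
          integral_Ioc_eq_integral_Ioo, h4]
      rw [integral_sub (hQi t) hind, hk t ht, add_sub_cancel_left, h3]
    rw [h2] at h1
    have h3 := Γ.add_mem (Γ.add_mem hx₀ (hSΓ t ht η)) h1
    convert h3 using 1
    ext
    · rfl
    · simp only [Prod.snd_add, hη]
      abel
  · rw [mul_add]
    refine (norm_add_le _ _).trans (add_le_add (hSb _ _) ?_)
    rw [← integral_const_mul]
    exact norm_integral_le_of_norm_le hbi (Eventually.of_forall (hQb t))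

open MeasureTheory Filter Topology BoundedContinuousFunction in
/-- Local classical solvability of the semilinear Cauchy problem. -/
theorem exists_semilinear_solution [CompleteSpace X] (h : IsQuasiMaxDissipative Γ ω) {F : X → X}
    (hF : ∀ ρ > 0, ∃ L : ℝ, 0 ≤ L ∧ ∀ a b, ‖a‖ ≤ ρ → ‖b‖ ≤ ρ → ‖F a - F b‖ ≤ L * ‖a - b‖)
    {g g' : ℝ → X} (hg' : IntegrableOn g' (Ioc 0 1))
    (hg : ∀ t ∈ Icc (0:ℝ) 1, g t = g 0 + ∫ s in (0:ℝ)..t, g' s) {x₀ y₀ : X}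
    (hx₀ : (x₀, y₀) ∈ Γ) :
    ∃ T > 0, T ≤ 1 ∧ ∃ x x' : ℝ → X, x 0 = x₀ ∧
      (∀ t ∈ Icc 0 T, HasDerivWithinAt x (x' t) (Icc 0 T) t) ∧ ContinuousOn x' (Icc 0 T) ∧
      (∃ C, LipschitzWith C x) ∧ ∀ t ∈ Icc 0 T, (x t, x' t - (F (x t) + g t)) ∈ Γ := by
  have hω := h.nonneg
  obtain ⟨L, hL, hFL⟩ := hF (‖x₀‖ + 1) (by positivity)
  obtain ⟨M, hM⟩ : ∃ M : NNReal,
      (M : ℝ) = 2 * (‖y₀ + (F x₀ + g 0)‖ + (1 + ∫ s in Ioc 0 1, ‖g' s‖)) := by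
    refine ⟨⟨_, ?_⟩, rfl⟩
    have : 0 ≤ ∫ s in Ioc (0:ℝ) 1, ‖g' s‖ := integral_nonneg fun _ => norm_nonneg _
    positivity
  obtain ⟨L', hL'⟩ : ∃ L' : NNReal, (L' : ℝ) = L := ⟨⟨L, hL⟩, rfl⟩
  have hM0 : (0:ℝ) ≤ M := M.2
  set N : ℝ := 8 * ω + 1 + L * M + M + 8 * L ^ 2 with hN
  have hN1 : 1 ≤ N := by
    have := mul_nonneg hL hM0
    nlinarith [sq_nonneg L]
  have hN0 : 0 < N := by linarith
  have hbound : ∀ a, a ≤ N → a * N⁻¹ ≤ 1 := fun a ha => by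
    rw [← div_eq_mul_inv]; exact (div_le_one hN0).2 ha
  set T : ℝ := N⁻¹ with hT
  have hT0 : 0 < T := inv_pos.2 hN0
  have hLM := mul_nonneg hL hM0
  have hT1 : T ≤ 1 := by simpa using hbound 1 hN1
  have hT2 : (8 * ω + 1) * T ≤ 1 := hbound _ (by nlinarith [sq_nonneg L])
  have hT3 : L * M * T ≤ 1 := hbound _ (by nlinarith [sq_nonneg L])
  have hT4 : M * T ≤ 1 := hbound _ (by nlinarith [sq_nonneg L])
  have hT5 : 8 * L ^ 2 * T ≤ 1 := hbound _ (by nlinarith)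
  have hT6 : (2 * ω + 1) * T ≤ 1 := hbound _ (by nlinarith [sq_nonneg L])
  let c : ℝ → ℝ := fun t => max 0 (min t T)
  have hc : ∀ t, c t ∈ Icc 0 T := fun t => ⟨le_max_left _ _, max_le hT0.le (min_le_right _ _)⟩
  have hci : ∀ t ∈ Icc 0 T, c t = t := fun t ht => by simp [c, ht.1, ht.2]
  have hcl : LipschitzWith 1 c := (LipschitzWith.id.min_const T).const_max 0
  let s : Set (ℝ →ᵇ X) := {x | x 0 = x₀ ∧ (∀ a b, dist (x a) (x b) ≤ M * dist a b) ∧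
    ∀ t, dist (x t) x₀ ≤ 1}
  have hsc : IsComplete s := by
    refine IsClosed.isComplete ?_
    have h1 : IsClosed {x : ℝ →ᵇ X | x 0 = x₀} :=
      isClosed_eq (continuous_eval_const 0) continuous_const
    have h2 : IsClosed {x : ℝ →ᵇ X | ∀ a b, dist (x a) (x b) ≤ M * dist a b} := by
      simp only [Set.ofPred_forall]
      exact isClosed_iInter fun a => isClosed_iInter fun b =>
        isClosed_le ((continuous_eval_const a).dist (continuous_eval_const b)) continuous_const
    have h3 : IsClosed {x : ℝ →ᵇ X | ∀ t, dist (x t) x₀ ≤ 1} := by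
      simp only [Set.ofPred_forall]
      exact isClosed_iInter fun a =>
        isClosed_le ((continuous_eval_const a).dist continuous_const) continuous_const
    exact h1.inter (h2.inter h3)
  have hsb : ∀ x ∈ s, ∀ t, ‖x t‖ ≤ ‖x₀‖ + 1 := fun x hx t => by
    have h1 := hx.2.2 t
    rw [dist_eq_norm] at h1
    have h2 := norm_add_le (x t - x₀) x₀
    rw [sub_add_cancel] at h2
    linarith
  have hstep : ∀ x ∈ s, ∃ y ∈ s, (∀ t, y t = y (c t)) ∧ ∃ y' : ℝ → X,
      (∀ t ∈ Icc 0 T, HasDerivWithinAt y (y' t) (Icc 0 T) t) ∧ ContinuousOn y' (Icc 0 T) ∧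
      ∀ t ∈ Icc 0 T, (y t, y' t - (F (x t) + g t)) ∈ Γ := by
    intro x hx
    have hFx : LipschitzWith (L' * M) fun t => F (x t) := by
      refine LipschitzWith.of_dist_le_mul fun a b => ?_
      rw [dist_eq_norm]
      refine (hFL _ _ (hsb x hx a) (hsb x hx b)).trans ?_
      rw [← dist_eq_norm, NNReal.coe_mul, hL', mul_assoc]
      exact mul_le_mul_of_nonneg_left (hx.2.1 a b) hL
    obtain ⟨σ, hσ, hFσ, hσb⟩ := hFx.exists_eq_integral hT0.le
    have hgT : IntegrableOn g' (Ioc 0 T) := hg'.mono_set (Ioc_subset_Ioc_right hT1)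
    have hii : ∀ {u : ℝ → X}, IntegrableOn u (Ioc 0 T) → ∀ t ∈ Icc 0 T,
        IntervalIntegrable u volume 0 t := fun hu t ht =>
      (intervalIntegrable_iff_integrableOn_Ioc_of_le ht.1).2
        (hu.mono_set (Ioc_subset_Ioc_right ht.2))
    obtain ⟨z, z', hz0, hz, hz'c, hzΓ, hzb⟩ := h.exists_linear_solution hT0 hT2
      (k := fun t => F (x t) + g t) (k' := fun t => σ t + g' t) (hσ.add hgT)
      (fun t ht => by
        rw [intervalIntegral.integral_add (hii hσ t ht) (hii hgT t ht), hFσ t ht,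
          hg t ⟨ht.1, ht.2.trans hT1⟩]
        abel) hx₀
    have hz'M : ∀ t, ‖z' t‖ ≤ M := fun t => by
      refine (hzb t).trans ?_
      rw [hM, hx.1]
      have h1 : ∫ s in Ioc 0 T, ‖σ s + g' s‖ ≤ ∫ s in Ioc 0 T, (‖σ s‖ + ‖g' s‖) :=
        integral_mono (hσ.add hgT).norm (hσ.norm.add hgT.norm) fun s => norm_add_le _ _
      have h2 : ∫ s in Ioc 0 T, (‖σ s‖ + ‖g' s‖) =
          (∫ s in Ioc 0 T, ‖σ s‖) + ∫ s in Ioc 0 T, ‖g' s‖ := integral_add hσ.norm hgT.norm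
      have h3 : ∫ s in Ioc 0 T, ‖g' s‖ ≤ ∫ s in Ioc 0 1, ‖g' s‖ :=
        setIntegral_mono_set hg'.norm (Eventually.of_forall fun _ => norm_nonneg _)
          (Ioc_subset_Ioc_right hT1).eventuallyLE
      rw [NNReal.coe_mul, hL'] at hσb
      gcongr
      linarith
    have hzl : LipschitzWith M z := lipschitzWith_of_nnnorm_deriv_le
      (fun t => (hz t).differentiableAt) fun t => by rw [(hz t).deriv]; exact hz'M t
    have hyl : LipschitzWith M fun t => z (c t) := by
      have := hzl.comp hcl
      rw [mul_one] at this
      exact this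
    have hyb : ∀ t, dist (z (c t)) x₀ ≤ 1 := fun t => by
      rw [← hz0]
      refine (hzl.dist_le_mul _ _).trans (le_trans ?_ hT4)
      gcongr
      rw [Real.dist_eq, sub_zero, abs_of_nonneg (hc t).1]
      exact (hc t).2
    let y : ℝ →ᵇ X := BoundedContinuousFunction.ofNormedAddCommGroup (fun t => z (c t))
      hyl.continuous (1 + ‖x₀‖) fun t => by
        have h1 := hyb t
        rw [dist_eq_norm] at h1
        have h2 := norm_add_le (z (c t) - x₀) x₀
        rw [sub_add_cancel] at h2
        linarith
    have hyz : ∀ t ∈ Icc 0 T, y t = z t := fun t ht => by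
      change z (c t) = z t
      rw [hci t ht]
    have h0 : (0:ℝ) ∈ Icc 0 T := ⟨le_rfl, hT0.le⟩
    refine ⟨y, ⟨(hyz 0 h0).trans hz0, fun a b => hyl.dist_le_mul a b, hyb⟩, fun t => ?_, z',
      fun t ht => (hz t).hasDerivWithinAt.congr hyz (hyz t ht), hz'c.continuousOn, fun t ht => ?_⟩
    · change z (c t) = z (c (c t))
      rw [hci _ (hc t)]
    · rw [hyz t ht]
      exact hzΓ t ht
  choose! Φ hΦs hΦc Φ' hΦd hΦ'c hΦΓ using hstep
  have hmaps : MapsTo Φ s s := fun x hx => hΦs x hx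
  have hcontr : ContractingWith 2⁻¹ (hmaps.restrict Φ s s) := by
    refine ⟨by norm_num, LipschitzWith.of_dist_le_mul fun x₁ x₂ => ?_⟩
    obtain ⟨x₁, h₁⟩ := x₁
    obtain ⟨x₂, h₂⟩ := x₂
    change dist (Φ x₁) (Φ x₂) ≤ ((2⁻¹ : NNReal) : ℝ) * dist x₁ x₂
    set D := dist x₁ x₂ with hD
    have hD0 : 0 ≤ D := dist_nonneg
    have hD' : ∀ t, ‖F (x₁ t) - F (x₂ t)‖ ≤ L * D := fun t => by
      refine (hFL _ _ (hsb x₁ h₁ t) (hsb x₂ h₂ t)).trans ?_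
      rw [← dist_eq_norm]
      exact mul_le_mul_of_nonneg_left (dist_coe_le_dist t) hL
    have hest : ∀ t ∈ Icc 0 T, dist (Φ x₁ t) (Φ x₂ t) ≤ 2⁻¹ * D := fun t ht => by
      have := sq_norm_le_of_dissipative (x := fun t => Φ x₁ t - Φ x₂ t)
        (x' := fun t => Φ' x₁ t - Φ' x₂ t) (K := 2 * ω + 1) (ε := (L * D) ^ 2)
        (by positivity) hT6 (by positivity)
        (fun t ht => (hΦd x₁ h₁ t ht).sub (hΦd x₂ h₂ t ht))
        (fun t ht => by
          have h3 := h.inner_le _ _ (Γ.sub_mem (hΦΓ x₁ h₁ t ht) (hΦΓ x₂ h₂ t ht))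
          have h4 : Φ' x₁ t - (F (x₁ t) + g t) - (Φ' x₂ t - (F (x₂ t) + g t)) =
            (Φ' x₁ t - Φ' x₂ t) - (F (x₁ t) - F (x₂ t)) := by abel
          rw [h4, inner_sub_right] at h3
          have h5 := real_inner_le_norm (Φ x₁ t - Φ x₂ t) (F (x₁ t) - F (x₂ t))
          have h6 := mul_le_mul_of_nonneg_left (hD' t) (norm_nonneg (Φ x₁ t - Φ x₂ t))
          nlinarith [sq_nonneg (‖Φ x₁ t - Φ x₂ t‖ - L * D)]) t ht
      simp only [(hΦs x₁ h₁).1, (hΦs x₂ h₂).1, sub_self, norm_zero] at this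
      rw [dist_eq_norm]
      refine le_of_sq_le_sq (this.trans ?_) (by positivity)
      have h7 : 8 * L ^ 2 * t ≤ 1 :=
        (mul_le_mul_of_nonneg_left ht.2 (by positivity)).trans hT5
      nlinarith [mul_le_mul_of_nonneg_right h7 (sq_nonneg D)]
    rw [dist_le (by positivity)]
    intro t
    rw [hΦc x₁ h₁ t, hΦc x₂ h₂ t]
    simpa using hest _ (hc t)
  have hs0 : BoundedContinuousFunction.const ℝ x₀ ∈ s := by
    refine ⟨rfl, fun a b => ?_, fun t => ?_⟩
    · simp; positivity
    · simp
  obtain ⟨x, hx, hfix, -⟩ := ContractingWith.exists_fixedPoint' hsc hmaps hcontr hs0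
    (edist_ne_top _ _)
  have hfix' : Φ x = x := hfix
  have hd := hΦd x hx
  have hΓ := hΦΓ x hx
  rw [hfix'] at hd hΓ
  exact ⟨T, hT0, hT1, x, Φ' x, hx.1, hd, hΦ'c x hx, ⟨M, LipschitzWith.of_dist_le_mul hx.2.1⟩, hΓ⟩

theorem eqOn_of_semilinear (h : IsQuasiMaxDissipative Γ ω) {F : X → X}
    (hF : ∀ ρ > 0, ∃ L : ℝ, 0 ≤ L ∧ ∀ a b, ‖a‖ ≤ ρ → ‖b‖ ≤ ρ → ‖F a - F b‖ ≤ L * ‖a - b‖)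
    {g x₁ x₁' x₂ x₂' : ℝ → X} {T : ℝ}
    (hx₁ : ∀ t ∈ Icc 0 T, HasDerivWithinAt x₁ (x₁' t) (Icc 0 T) t)
    (hΓ₁ : ∀ t ∈ Icc 0 T, (x₁ t, x₁' t - (F (x₁ t) + g t)) ∈ Γ)
    (hx₂ : ∀ t ∈ Icc 0 T, HasDerivWithinAt x₂ (x₂' t) (Icc 0 T) t)
    (hΓ₂ : ∀ t ∈ Icc 0 T, (x₂ t, x₂' t - (F (x₂ t) + g t)) ∈ Γ) (h0 : x₁ 0 = x₂ 0) :
    EqOn x₁ x₂ (Icc 0 T) := by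
  obtain ⟨ρ₁, hρ₁⟩ := isCompact_Icc.exists_bound_of_continuousOn
    fun t ht => (hx₁ t ht).continuousWithinAt
  obtain ⟨ρ₂, hρ₂⟩ := isCompact_Icc.exists_bound_of_continuousOn
    fun t ht => (hx₂ t ht).continuousWithinAt
  obtain ⟨L, -, hFL⟩ := hF (max 1 (max ρ₁ ρ₂)) (by positivity)
  intro t ht
  have key := sq_norm_le_gronwallBound (x := fun t => x₁ t - x₂ t) (K := 2 * (ω + L)) (ε := 0)
    (fun t ht => (hx₁ t ht).sub (hx₂ t ht)) (fun t ht => by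
      have h₁ := h.inner_le _ _ (Γ.sub_mem (hΓ₁ t ht) (hΓ₂ t ht))
      have h₂ : x₁' t - (F (x₁ t) + g t) - (x₂' t - (F (x₂ t) + g t)) =
        (x₁' t - x₂' t) - (F (x₁ t) - F (x₂ t)) := by abel
      rw [h₂, inner_sub_right] at h₁
      have h₃ := real_inner_le_norm (x₁ t - x₂ t) (F (x₁ t) - F (x₂ t))
      have h₄ := mul_le_mul_of_nonneg_left (hFL _ _
        ((hρ₁ t ht).trans ((le_max_left _ _).trans (le_max_right _ _)))
        ((hρ₂ t ht).trans ((le_max_right _ _).trans (le_max_right _ _))))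
        (norm_nonneg (x₁ t - x₂ t))
      linarith) t ht
  simp only [h0, sub_self, norm_zero, ne_eq, OfNat.ofNat_ne_zero, not_false_eq_true, zero_pow,
    gronwallBound_ε0_δ0] at key
  exact sub_eq_zero.1 (norm_eq_zero.1 (pow_eq_zero_iff two_ne_zero |>.1
    (key.antisymm (sq_nonneg _))))

end IsQuasiMaxDissipative

theorem IsCoercive.exists_forall_eq {V : Type*} [NormedAddCommGroup V] [InnerProductSpace ℝ V]
    [CompleteSpace V] {A : V →L[ℝ] V →L[ℝ] ℝ} (hA : IsCoercive A) (ψ : V →L[ℝ] ℝ) :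
    ∃ v, ∀ w, A v w = ψ w := by
  refine ⟨hA.continuousLinearEquivOfBilin.symm ((InnerProductSpace.toDual ℝ V).symm ψ),
    fun w => ?_⟩
  rw [← hA.continuousLinearEquivOfBilin_apply, ContinuousLinearEquiv.apply_symm_apply,
    InnerProductSpace.toDual_symm_apply]

theorem WithLp.norm_fst_add_norm_snd_le {E F : Type*} [NormedAddCommGroup E]
    [NormedAddCommGroup F] (x : WithLp 2 (E × F)) : ‖x.fst‖ + ‖x.snd‖ ≤ 2 * ‖x‖ := by
  have := WithLp.prod_norm_sq_eq_of_L2 x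
  refine le_of_sq_le_sq ?_ (by positivity)
  nlinarith [sq_nonneg (‖x.fst‖ - ‖x.snd‖), sq_nonneg ‖x‖]

section DampedWave

variable {H V : Type*} [NormedAddCommGroup H] [InnerProductSpace ℝ H]
  [NormedAddCommGroup V] [InnerProductSpace ℝ V]

/-- The graph of the first-order operator of the damped wave equation on the energy space `V × H`:
it maps `(u, J v)` to `(v, y)`, where `-y` represents the functional
`⟪u, ·⟫ - c ⟪J u, J ·⟫ + B v`. -/
def dampedWaveRelation (J : V →L[ℝ] H) (c : ℝ) (B : V →L[ℝ] V →L[ℝ] ℝ) :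
    Submodule ℝ (WithLp 2 (V × H) × WithLp 2 (V × H)) where
  carrier := {p | p.1.snd = J p.2.fst ∧
    ∀ w, -⟪p.2.snd, J w⟫ = ⟪p.1.fst, w⟫ - c * ⟪J p.1.fst, J w⟫ + B p.2.fst w}
  zero_mem' := by simp
  add_mem' := by
    rintro p q ⟨hp₁, hp₂⟩ ⟨hq₁, hq₂⟩
    refine ⟨by simp [hp₁, hq₁], fun w => ?_⟩
    have h₁ := hp₂ w
    have h₂ := hq₂ w
    simp only [Prod.fst_add, Prod.snd_add, WithLp.add_fst, WithLp.add_snd, map_add, inner_add_left,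
      _root_.add_apply]
    linarith
  smul_mem' := by
    rintro r p ⟨hp₁, hp₂⟩
    refine ⟨by simp [hp₁], fun w => ?_⟩
    have h₁ := hp₂ w
    simp only [Prod.smul_fst, Prod.smul_snd, WithLp.smul_fst, WithLp.smul_snd, map_smul,
      real_inner_smul_left, _root_.smul_apply, smul_eq_mul]
    linear_combination r * h₁

variable {J : V →L[ℝ] H} {c : ℝ} {B : V →L[ℝ] V →L[ℝ] ℝ}

theorem mem_dampedWaveRelation {x y : WithLp 2 (V × H)} :
    (x, y) ∈ dampedWaveRelation J c B ↔ x.snd = J y.fst ∧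
      ∀ w, -⟪y.snd, J w⟫ = ⟪x.fst, w⟫ - c * ⟪J x.fst, J w⟫ + B y.fst w := Iff.rfl

theorem inner_le_of_mem_dampedWaveRelation {q : ℝ} (hc : 0 ≤ c)
    (hq : 0 ≤ q) (hB : ∀ v, -(q * ‖J v‖ ^ 2) ≤ B v v) {x y : WithLp 2 (V × H)}
    (hxy : (x, y) ∈ dampedWaveRelation J c B) : ⟪x, y⟫ ≤ (c * ‖J‖ + q) * ‖x‖ ^ 2 := by
  obtain ⟨h₁, h₂⟩ := hxy
  dsimp only at h₁ h₂
  have h₃ := h₂ y.fst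
  have h₄ := hB y.fst
  rw [← h₁] at h₃ h₄
  rw [WithLp.prod_inner_apply, WithLp.prod_norm_sq_eq_of_L2, real_inner_comm]
  change ⟪y.fst, x.fst⟫ + ⟪x.snd, y.snd⟫ ≤ _
  rw [real_inner_comm y.snd, real_inner_comm x.fst]
  have h₅ : ⟪J x.fst, x.snd⟫ ≤ ‖J‖ * ‖x.fst‖ * ‖x.snd‖ :=
    (real_inner_le_norm _ _).trans (mul_le_mul_of_nonneg_right (J.le_opNorm _) (norm_nonneg _))
  have h₆ := mul_le_mul_of_nonneg_left h₅ hc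
  have h₇ := mul_nonneg hc (norm_nonneg J)
  nlinarith [mul_nonneg h₇ (sq_nonneg (‖x.fst‖ - ‖x.snd‖)), mul_nonneg h₇ (sq_nonneg ‖x.fst‖),
    mul_nonneg h₇ (sq_nonneg ‖x.snd‖), mul_nonneg hq (sq_nonneg ‖x.fst‖)]

theorem isQuasiMaxDissipative_dampedWaveRelation [CompleteSpace V] {q : ℝ}
    (hJ : Function.Injective J) (hJd : DenseRange J) (hc : 0 ≤ c) (hq : 0 ≤ q)
    (hB : ∀ v, -(q * ‖J v‖ ^ 2) ≤ B v v) :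
    IsQuasiMaxDissipative (dampedWaveRelation J c B) (c * ‖J‖ + q) where
  nonneg := by positivity
  inner_le _ _ := inner_le_of_mem_dampedWaveRelation hc hq hB
  surj := by
    refine ⟨c + q + 1, fun l hl z => ?_⟩
    have hl1 : 1 ≤ l := by linarith
    have hl0 : 0 < l := by linarith
    have hli : l⁻¹ ≤ 1 := inv_le_one_of_one_le₀ hl1
    have hli0 : 0 < l⁻¹ := inv_pos.2 hl0
    let I : V →L[ℝ] V →L[ℝ] ℝ := (isBoundedBilinearMap_inner (𝕜 := ℝ)).toContinuousLinearMap
    let K : V →L[ℝ] V →L[ℝ] ℝ :=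
      ((isBoundedBilinearMap_inner (𝕜 := ℝ) (E := H)).toContinuousLinearMap).bilinearComp J J
    have hI : ∀ v w, I v w = ⟪v, w⟫ := fun _ _ => rfl
    have hK : ∀ v w, K v w = ⟪J v, J w⟫ := fun _ _ => rfl
    have hA : IsCoercive (l • K + l⁻¹ • (I - c • K) + B) := by
      refine ⟨l⁻¹, hli0, fun v => ?_⟩
      simp only [_root_.add_apply, _root_.smul_apply,
        _root_.sub_apply, hI, hK, real_inner_self_eq_norm_sq, smul_eq_mul]
      have h₁ := mul_le_mul_of_nonneg_right hli hc
      have h₂ : 0 ≤ (l - l⁻¹ * c - q) * ‖J v‖ ^ 2 :=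
        mul_nonneg (by linarith) (sq_nonneg _)
      nlinarith [hB v]
    obtain ⟨v, hv⟩ := hA.exists_forall_eq (innerSL ℝ z.snd ∘L J - l⁻¹ • (I - c • K) z.fst)
    refine ⟨WithLp.toLp 2 (l⁻¹ • (z.fst + v), J v), WithLp.toLp 2 (v, l • J v - z.snd),
      ⟨rfl, fun w => ?_⟩, ?_⟩
    · have h₁ := hv w
      simp only [_root_.add_apply, _root_.smul_apply,
        _root_.sub_apply, ContinuousLinearMap.comp_apply, innerSL_apply_apply, hI, hK,
        smul_eq_mul] at h₁
      change -⟪l • J v - z.snd, J w⟫ =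
        ⟪l⁻¹ • (z.fst + v), w⟫ - c * ⟪J (l⁻¹ • (z.fst + v)), J w⟫ + B v w
      simp only [inner_sub_left, real_inner_smul_left, map_smul, map_add, inner_add_left]
      linear_combination -h₁
    · apply WithLp.ofLp_injective
      ext
      · simp [smul_smul, hl0.ne']
      · simp
  eq_zero := by
    rintro y ⟨h₁, h₂⟩
    have h₃ : y.fst = 0 := hJ (by simpa using h₁.symm)
    have h₄ : y.snd = 0 := by
      refine hJd.eq_zero_of_inner_left ℝ fun w => ?_
      have := h₂ w
      simp only [h₃] at this
      simpa using this
    exact WithLp.ofLp_injective 2 (Prod.ext h₃ h₄)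

/-- The nonlinearity of the damped wave equation as a map on the energy space. -/
def dampedWaveNonlinearity (G : V → H → H) (x : WithLp 2 (V × H)) : WithLp 2 (V × H) :=
  WithLp.toLp 2 (0, G x.fst x.snd)

theorem sub_dampedWaveNonlinearity_mem {G : V → H → H} {x y : WithLp 2 (V × H)} {k : H} :
    (x, y - (dampedWaveNonlinearity G x + WithLp.toLp 2 (0, k))) ∈ dampedWaveRelation J c B ↔
      x.snd = J y.fst ∧ ∀ w, ⟪G x.fst x.snd + k - y.snd, J w⟫ =
        ⟪x.fst, w⟫ - c * ⟪J x.fst, J w⟫ + B y.fst w := by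
  have h₁ : (y - (dampedWaveNonlinearity G x + WithLp.toLp 2 (0, k))).fst = y.fst := by
    simp [dampedWaveNonlinearity]
  have h₂ : (y - (dampedWaveNonlinearity G x + WithLp.toLp 2 (0, k))).snd =
      -(G x.fst x.snd + k - y.snd) := (neg_sub _ _).symm
  simp only [mem_dampedWaveRelation, h₁, h₂, inner_neg_left, neg_neg]

omit [InnerProductSpace ℝ H] [InnerProductSpace ℝ V] in
theorem norm_dampedWaveNonlinearity_sub_le {G : V → H → H}
    (hG : ∀ ρ > 0, ∃ L : ℝ, 0 ≤ L ∧ ∀ (v₁ v₂ : V) (w₁ w₂ : H), ‖v₁‖ + ‖w₁‖ ≤ ρ →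
      ‖v₂‖ + ‖w₂‖ ≤ ρ → ‖G v₁ w₁ - G v₂ w₂‖ ≤ L * (‖v₁ - v₂‖ + ‖w₁ - w₂‖)) :
    ∀ ρ > 0, ∃ L : ℝ, 0 ≤ L ∧ ∀ x y : WithLp 2 (V × H), ‖x‖ ≤ ρ → ‖y‖ ≤ ρ →
      ‖dampedWaveNonlinearity G x - dampedWaveNonlinearity G y‖ ≤ L * ‖x - y‖ := by
  intro ρ hρ
  obtain ⟨L, hL, h⟩ := hG (2 * ρ) (by positivity)
  refine ⟨L * 2, by positivity, fun x y hx hy => ?_⟩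
  have h₁ : dampedWaveNonlinearity G x - dampedWaveNonlinearity G y =
      WithLp.toLp 2 (0, G x.fst x.snd - G y.fst y.snd) := by
    simp [dampedWaveNonlinearity, ← WithLp.toLp_sub]
  rw [h₁, WithLp.norm_toLp_snd, mul_assoc]
  exact (h _ _ _ _ ((WithLp.norm_fst_add_norm_snd_le x).trans (by linarith))
    ((WithLp.norm_fst_add_norm_snd_le y).trans (by linarith))).trans
    (mul_le_mul_of_nonneg_left (WithLp.norm_fst_add_norm_snd_le (x - y)) hL)

section Solution

variable {G : V → H → H} {f : ℝ → H} {u0 v0 : V} {T : ℝ} {u u' : ℝ → V} {u'' hrep : ℝ → H}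

theorem IsDampedWaveSolution.hasDerivWithinAt_toLp
    (h : IsDampedWaveSolution (J : V →ₗ[ℝ] H) (fun v w => ⟪v, w⟫ - c * ⟪J v, J w⟫)
      (fun v w => B v w) G f u0 v0 T u u' u'' hrep) {t : ℝ} (ht : t ∈ Icc 0 T) :
    HasDerivWithinAt (fun t => WithLp.toLp 2 (u t, J (u' t))) (WithLp.toLp 2 (u' t, u'' t))
      (Icc 0 T) t :=
  ((WithLp.prodContinuousLinearEquiv 2 ℝ V H).symm : V × H →L[ℝ] WithLp 2 (V × H)).hasFDerivAt
    |>.comp_hasDerivWithinAt t ((h.1 t ht).prodMk (h.2.2.2.1 t ht))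

theorem IsDampedWaveSolution.toLp_mem
    (h : IsDampedWaveSolution (J : V →ₗ[ℝ] H) (fun v w => ⟪v, w⟫ - c * ⟪J v, J w⟫)
      (fun v w => B v w) G f u0 v0 T u u' u'' hrep) {t : ℝ} (ht : t ∈ Icc 0 T) :
    (WithLp.toLp 2 (u t, J (u' t)), WithLp.toLp 2 (u' t, u'' t) -
      (dampedWaveNonlinearity G (WithLp.toLp 2 (u t, J (u' t))) + WithLp.toLp 2 (0, f t))) ∈
      dampedWaveRelation J c B := by
  refine sub_dampedWaveNonlinearity_mem.2 ⟨rfl, fun w => ?_⟩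
  have h₁ := h.2.2.2.2.1 t ht w
  simp only [ContinuousLinearMap.coe_coe] at h₁
  change ⟪G (u t) (J (u' t)) + f t - u'' t, J w⟫ = ⟪u t, w⟫ - c * ⟪J (u t), J w⟫ + B (u' t) w
  rw [inner_sub_left, inner_add_left]
  linarith

theorem exists_isDampedWaveSolution {ω : ℝ} [CompleteSpace H] [CompleteSpace V]
    (hΓ : IsQuasiMaxDissipative (dampedWaveRelation J c B) ω) (hJ : Function.Injective J)
    (hG : ∀ ρ > 0, ∃ L : ℝ, 0 ≤ L ∧ ∀ (v₁ v₂ : V) (w₁ w₂ : H), ‖v₁‖ + ‖w₁‖ ≤ ρ →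
      ‖v₂‖ + ‖w₂‖ ≤ ρ → ‖G v₁ w₁ - G v₂ w₂‖ ≤ L * (‖v₁ - v₂‖ + ‖w₁ - w₂‖))
    {f' : ℝ → H} (hf' : MeasureTheory.IntegrableOn f' (Icc 0 1))
    (hf : ∀ t ∈ Icc (0 : ℝ) 1, f t = f 0 + ∫ s in (0 : ℝ)..t, f' s) {h0 : H}
    (hh0 : ∀ w, ⟪h0, J w⟫ = ⟪u0, w⟫ - c * ⟪J u0, J w⟫ + B v0 w) :
    ∃ T > 0, ∃ u u' u'' hrep,
      IsDampedWaveSolution (J : V →ₗ[ℝ] H) (fun v w => ⟪v, w⟫ - c * ⟪J v, J w⟫)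
        (fun v w => B v w) G f u0 v0 T u u' u'' hrep := by
  let S : H →L[ℝ] WithLp 2 (V × H) :=
    ((WithLp.prodContinuousLinearEquiv 2 ℝ V H).symm : V × H →L[ℝ] _) ∘L
      ContinuousLinearMap.inr ℝ V H
  have hf'' : MeasureTheory.IntegrableOn f' (Ioc 0 1) := hf'.mono_set Ioc_subset_Icc_self
  have hfi : ∀ t ∈ Icc (0 : ℝ) 1, IntervalIntegrable f' MeasureTheory.volume 0 t := fun t ht =>
    (intervalIntegrable_iff_integrableOn_Ioc_of_le ht.1).2
      (hf''.mono_set (Ioc_subset_Ioc_right ht.2))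
  have hF := norm_dampedWaveNonlinearity_sub_le hG
  obtain ⟨T, hT, hT1, x, x', hx0, hd, hx'c, ⟨C, hC⟩, hm⟩ := hΓ.exists_semilinear_solution
    (F := dampedWaveNonlinearity G) hF
    (g := fun t => S (f t)) (g' := fun t => S (f' t)) (S.integrable_comp hf'') (fun t ht => by
      rw [S.intervalIntegral_comp_comm (hfi t ht), ← map_add, ← hf t ht])
    (x₀ := WithLp.toLp 2 (u0, J v0)) (y₀ := WithLp.toLp 2 (v0, -h0)) ⟨rfl, fun w => by
      simpa using hh0 w⟩
  have hxJ : ∀ t ∈ Icc 0 T, J (x' t).fst = (x t).snd := fun t ht =>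
    (sub_dampedWaveNonlinearity_mem.1 (hm t ht)).1.symm
  have hrel : ∀ t ∈ Icc 0 T, ∀ w, ⟪G (x t).fst (x t).snd + f t - (x' t).snd, J w⟫ =
      ⟪(x t).fst, w⟫ - c * ⟪J (x t).fst, J w⟫ + B (x' t).fst w := fun t ht =>
    (sub_dampedWaveNonlinearity_mem.1 (hm t ht)).2
  have hGc : ContinuousOn (fun t => G (x t).fst (x t).snd) (Icc 0 T) := by
    obtain ⟨ρ, hρ⟩ := isCompact_Icc.exists_bound_of_continuousOn
      (s := Icc 0 T) hC.continuous.continuousOn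
    obtain ⟨L, hL, hFL⟩ := hF (max 1 ρ) (by positivity)
    refine (LipschitzOnWith.of_dist_le_mul (K := Real.toNNReal L * C)
      fun s hs t ht => ?_).continuousOn
    have h₁ := hFL _ _ ((hρ s hs).trans (le_max_right _ _)) ((hρ t ht).trans (le_max_right _ _))
    have h₂ : ‖G (x s).fst (x s).snd - G (x t).fst (x t).snd‖ ≤
        ‖dampedWaveNonlinearity G (x s) - dampedWaveNonlinearity G (x t)‖ :=
      WithLp.norm_snd_le _ (dampedWaveNonlinearity G (x s) - dampedWaveNonlinearity G (x t))
    rw [dist_eq_norm]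
    refine (h₂.trans h₁).trans ?_
    rw [← dist_eq_norm, NNReal.coe_mul, Real.coe_toNNReal L hL, mul_assoc]
    exact mul_le_mul_of_nonneg_left (hC.dist_le_mul s t) hL
  have hfc : ContinuousOn f (Icc 0 T) := by
    have h₁ := intervalIntegral.continuousOn_primitive_interval (a := 0) (b := 1) (f := f')
      (by rwa [uIcc_of_le zero_le_one])
    rw [uIcc_of_le zero_le_one] at h₁
    exact (((continuousOn_const (c := f 0)).add h₁).congr hf).mono (Icc_subset_Icc_right hT1)
  have h0T : (0 : ℝ) ∈ Icc 0 T := ⟨le_rfl, hT.le⟩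
  refine ⟨T, hT, fun t => (x t).fst, fun t => (x' t).fst, fun t => (x' t).snd,
    fun t => G (x t).fst (x t).snd + f t - (x' t).snd, fun t ht => ?_, ?_, ⟨C, ?_⟩,
    fun t ht => ?_, fun t ht w => ?_, ?_, ?_, ?_, hrel⟩
  · exact (WithLp.fstL 2 ℝ V H).hasFDerivAt.comp_hasDerivWithinAt t (hd t ht)
  · exact (WithLp.fstL 2 ℝ V H).continuous.comp_continuousOn hx'c
  · refine LipschitzOnWith.of_dist_le_mul fun s hs t ht => ?_
    simp only [ContinuousLinearMap.coe_coe]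
    rw [hxJ s hs, hxJ t ht]
    refine le_trans ?_ (hC.dist_le_mul s t)
    rw [dist_eq_norm, dist_eq_norm]
    exact WithLp.norm_snd_le _ (x s - x t)
  · exact ((WithLp.sndL 2 ℝ V H).hasFDerivAt.comp_hasDerivWithinAt t (hd t ht)).congr hxJ (hxJ t ht)
  · have h₁ := hrel t ht w
    simp only [ContinuousLinearMap.coe_coe, hxJ t ht]
    rw [inner_sub_left, inner_add_left] at h₁
    linarith
  · exact congrArg WithLp.fst hx0
  · exact hJ ((hxJ 0 h0T).trans (congrArg WithLp.snd hx0))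
  · exact (hGc.add hfc).sub ((WithLp.sndL 2 ℝ V H).continuous.comp_continuousOn hx'c)

end Solution

theorem IsDampedWaveSolution.mono {ι : V →ₗ[ℝ] H} {d b : V → V → ℝ} {G : V → H → H} {f : ℝ → H}
    {u0 v0 : V} {S T : ℝ} {u u' : ℝ → V} {u'' hrep : ℝ → H} (hST : S ≤ T)
    (h : IsDampedWaveSolution ι d b G f u0 v0 T u u' u'' hrep) :
    IsDampedWaveSolution ι d b G f u0 v0 S u u' u'' hrep := by
  have hs : Icc 0 S ⊆ Icc 0 T := Icc_subset_Icc_right hST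
  obtain ⟨h₁, h₂, ⟨K, h₃⟩, h₄, h₅, h₆, h₇, h₈, h₉⟩ := h
  exact ⟨fun t ht => (h₁ t (hs ht)).mono hs, h₂.mono hs, ⟨K, h₃.mono hs⟩,
    fun t ht => (h₄ t (hs ht)).mono hs, fun t ht => h₅ t (hs ht), h₆, h₇, h₈.mono hs,
    fun t ht => h₉ t (hs ht)⟩

end DampedWave

/-- local wellposedness.  Under the abstract assumptions, for all
initial data `u⁰, v⁰ ∈ V` with `A u⁰ + B v⁰ ∈ H` (i.e. there is `h⁰ ∈ H` representing
`w ↦ d(u⁰,w) + b(v⁰,w)`), there exists a maximal existence time `t* ∈ (0, ∞]` such that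
for every `0 < T` with `T < t*` the damped semilinear wave equation has a unique
solution on `[0,T]` in the sense of `IsDampedWaveSolution`. -/
theorem stmt0
    {H V : Type*}
    [NormedAddCommGroup H] [InnerProductSpace ℝ H] [CompleteSpace H]
    [NormedAddCommGroup V] [InnerProductSpace ℝ V] [CompleteSpace V]
    (ι : V →ₗ[ℝ] H) (hι : Function.Injective ι)
    (hdense : DenseRange (fun v : V => ι v))
    (C_HV : ℝ) (hembed : ∀ v : V, ‖ι v‖ ≤ C_HV * ‖v‖)
    (d : V → V → ℝ) (hd_symm : ∀ v w : V, d v w = d w v)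
    (Cd : ℝ) (hd_cont : ∀ v w : V, |d v w| ≤ Cd * ‖v‖ * ‖w‖)
    (c_G : ℝ) (hc_G : 0 ≤ c_G)
    (hV_inner : ∀ v w : V, ⟪v, w⟫ = d v w + c_G * ⟪ι v, ι w⟫)
    (b : V → V → ℝ)
    (hb_addl : ∀ v₁ v₂ w : V, b (v₁ + v₂) w = b v₁ w + b v₂ w)
    (hb_smull : ∀ (c : ℝ) (v w : V), b (c • v) w = c * b v w)
    (hb_addr : ∀ v w₁ w₂ : V, b v (w₁ + w₂) = b v w₁ + b v w₂)
    (hb_smulr : ∀ (c : ℝ) (v w : V), b v (c • w) = c * b v w)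
    (Cb : ℝ) (hb_cont : ∀ v w : V, |b v w| ≤ Cb * ‖v‖ * ‖w‖)
    (c_qm : ℝ) (hc_qm : 0 ≤ c_qm)
    (hb_qm : ∀ v : V, -(c_qm * ‖ι v‖ ^ 2) ≤ b v v)
    (G : V → H → H) (L : ℝ → ℝ) (hL : ∀ ρ : ℝ, 0 ≤ L ρ)
    (hG : ∀ ρ : ℝ, 0 < ρ → ∀ (v₁ v₂ : V) (w₁ w₂ : H),
      ‖v₁‖ + ‖w₁‖ ≤ ρ → ‖v₂‖ + ‖w₂‖ ≤ ρ →
      ‖G v₁ w₁ - G v₂ w₂‖ ≤ L ρ * (‖v₁ - v₂‖ + ‖w₁ - w₂‖))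
    (f : ℝ → H)
    (hf : ∀ T : ℝ, 0 < T → ∃ f' : ℝ → H,
      MeasureTheory.IntegrableOn f' (Icc (0 : ℝ) T) ∧
      ∀ t ∈ Icc (0 : ℝ) T, f t = f 0 + ∫ s in (0 : ℝ)..t, f' s)
    (u0 v0 : V) (h0 : H)
    (hh0 : ∀ w : V, ⟪h0, ι w⟫ = d u0 w + b v0 w) :
    ∃ tstar : ℝ≥0∞, 0 < tstar ∧
      ∀ T : ℝ, 0 < T → ENNReal.ofReal T < tstar →
        ∃ (u u' : ℝ → V) (u'' hrep : ℝ → H),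
          IsDampedWaveSolution ι d b G f u0 v0 T u u' u'' hrep ∧
          ∀ (u₂ u₂' : ℝ → V) (u₂'' hrep₂ : ℝ → H),
            IsDampedWaveSolution ι d b G f u0 v0 T u₂ u₂' u₂'' hrep₂ →
            EqOn u u₂ (Icc (0 : ℝ) T) := by
  obtain ⟨J, rfl⟩ : ∃ J : V →L[ℝ] H, (J : V →ₗ[ℝ] H) = ι := ⟨ι.mkContinuous C_HV hembed, rfl⟩
  obtain ⟨B, rfl⟩ : ∃ B : V →L[ℝ] V →L[ℝ] ℝ, (fun v w => B v w) = b :=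
    ⟨(LinearMap.mk₂ ℝ b hb_addl hb_smull hb_addr hb_smulr).mkContinuous₂ Cb hb_cont, rfl⟩
  obtain rfl : (fun v w => ⟪v, w⟫ - c_G * ⟪J v, J w⟫) = d := by
    ext v w
    exact sub_eq_of_eq_add (hV_inner v w)
  have hΓ := isQuasiMaxDissipative_dampedWaveRelation hι hdense hc_G hc_qm hb_qm
  have hG' : ∀ ρ > 0, ∃ L : ℝ, 0 ≤ L ∧ ∀ (v₁ v₂ : V) (w₁ w₂ : H), ‖v₁‖ + ‖w₁‖ ≤ ρ →
      ‖v₂‖ + ‖w₂‖ ≤ ρ → ‖G v₁ w₁ - G v₂ w₂‖ ≤ L * (‖v₁ - v₂‖ + ‖w₁ - w₂‖) :=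
    fun ρ hρ => ⟨L ρ, hL ρ, hG ρ hρ⟩
  obtain ⟨f', hf', hff'⟩ := hf 1 one_pos
  obtain ⟨T₀, hT₀, u, u', u'', hrep, hu⟩ := exists_isDampedWaveSolution hΓ hι hG' hf' hff' hh0
  refine ⟨ENNReal.ofReal T₀, ENNReal.ofReal_pos.2 hT₀, fun T _ hTT₀ => ?_⟩
  have huT := hu.mono ((ENNReal.ofReal_lt_ofReal_iff hT₀).1 hTT₀).le
  refine ⟨u, u', u'', hrep, huT, fun u₂ u₂' u₂'' hrep₂ hu₂ t ht => ?_⟩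
  have heq := hΓ.eqOn_of_semilinear (norm_dampedWaveNonlinearity_sub_le hG')
    (fun t => huT.hasDerivWithinAt_toLp) (fun t => huT.toLp_mem)
    (fun t => hu₂.hasDerivWithinAt_toLp) (fun t => hu₂.toLp_mem) (by
      obtain ⟨-, -, -, -, -, h₁, h₂, -⟩ := huT
      obtain ⟨-, -, -, -, -, h₃, h₄, -⟩ := hu₂
      rw [h₁, h₂, h₃, h₄]) ht
  exact congrArg WithLp.fst heq
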